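/- Fair languages are not compositional under synchronizing parallel composition: over Σ = {a, b, c}, let p be a single-state LTS with self-loops p →a p and p →b p, and let q be a two-state LTS with q →c q₁ and q₁ →a q. Let the composition (p, q) be the LTS on pairs of states where a transition with label x is possible iff every component in whose alphabet x lies takes an x-transition (so a is synchronized, b is performed by p alone, c by q alone). Then for F = {a} (under either strong or weak fairness), the infinite trace b^ω is not in the fair language of p, but b^ω is in the fair language of the composed process (p, q), since a is never enabled in the composition along the run staying in (p, q) taking only b-steps. -/

import Mathlib

/-- A labeled transition system over states `Q` and alphabet `σ`. -/
structure LTS (Q σ : Type) where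
  tr : Q → σ → Q → Prop

namespace LTS

variable {Q σ : Type}

/-- Action `a` is enabled in process `p`. -/
def Enabled (A : LTS Q σ) (p : Q) (a : σ) : Prop := ∃ p', A.tr p a p'

/-- `FinRun A p l q` : there is a finite run from `p` to `q` with trace `l`. -/
inductive FinRun (A : LTS Q σ) : Q → List σ → Q → Prop
  | nil (p : Q) : FinRun A p [] p
  | cons {p p' q : Q} {a : σ} {l : List σ} :
      A.tr p a p' → FinRun A p' l q → FinRun A p (a :: l) q

/-- Traces of finite runs of `p`. -/
def FinTraces (A : LTS Q σ) (p : Q) : Set (List σ) := {l | ∃ q, A.FinRun p l q}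

/-- An infinite run of `p` with state sequence `s` and label sequence `w`. -/
def InfRun (A : LTS Q σ) (p : Q) (s : ℕ → Q) (w : ℕ → σ) : Prop :=
  s 0 = p ∧ ∀ i, A.tr (s i) (w i) (s (i + 1))

/-- Traces of infinite runs of `p`. -/
def InfTraces (A : LTS Q σ) (p : Q) : Set (ℕ → σ) := {w | ∃ s, A.InfRun p s w}

/-- An infinite run (given by states `s` and labels `w`) is strong fair w.r.t. `F`:
for every `a ∈ F`, if `a` is enabled in infinitely many states then `a` occurs
infinitely often among the labels. -/
def StrongFair (A : LTS Q σ) (F : Set σ) (s : ℕ → Q) (w : ℕ → σ) : Prop :=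
  ∀ a ∈ F, (∀ i, ∃ j, i ≤ j ∧ A.Enabled (s j) a) → (∀ i, ∃ j, i ≤ j ∧ w j = a)

/-- An infinite run is weak fair w.r.t. `F`: for every `a ∈ F`, if from some point
on `a` is always enabled, then `a` occurs infinitely often among the labels. -/
def WeakFair (A : LTS Q σ) (F : Set σ) (s : ℕ → Q) (w : ℕ → σ) : Prop :=
  ∀ a ∈ F, (∃ i, ∀ j, i ≤ j → A.Enabled (s j) a) → (∀ i, ∃ j, i ≤ j ∧ w j = a)

/-- The strong fair language of `p` w.r.t. `F`: all traces of finite runs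
(finite runs are always fair) together with all traces of strong fair infinite runs. -/
def SFairLang (A : LTS Q σ) (F : Set σ) (p : Q) : Set (List σ ⊕ (ℕ → σ)) :=
  fun x => Sum.elim (fun l => l ∈ A.FinTraces p)
    (fun w => ∃ s, A.InfRun p s w ∧ A.StrongFair F s w) x

/-- The weak fair language of `p` w.r.t. `F`: all traces of finite runs
(finite runs are always fair) together with all traces of weak fair infinite runs. -/
def WFairLang (A : LTS Q σ) (F : Set σ) (p : Q) : Set (List σ ⊕ (ℕ → σ)) :=
  fun x => Sum.elim (fun l => l ∈ A.FinTraces p)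
    (fun w => ∃ s, A.InfRun p s w ∧ A.WeakFair F s w) x

end LTS

namespace LTS

/-- Synchronizing parallel composition of two LTS over a common action type,
relative to alphabets `S₁` and `S₂`: a transition labeled `x` exists iff `x` lies
in at least one alphabet, every component in whose alphabet `x` lies takes an
`x`-transition, and the other component stays in place. -/
def Sync {Q₁ Q₂ σ : Type} (A₁ : LTS Q₁ σ) (A₂ : LTS Q₂ σ) (S₁ S₂ : Set σ) :
    LTS (Q₁ × Q₂) σ where
  tr s x t :=
    (x ∈ S₁ ∨ x ∈ S₂) ∧
    (x ∈ S₁ → A₁.tr s.1 x t.1) ∧ (x ∉ S₁ → t.1 = s.1) ∧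
    (x ∈ S₂ → A₂.tr s.2 x t.2) ∧ (x ∉ S₂ → t.2 = s.2)

end LTS

/-- The three-letter alphabet `{a, b, c}`. -/
inductive Act3 : Type
  | a | b | c

/-- The single-state LTS `p` with self-loops `p →a p` and `p →b p`
(its alphabet is `{a, b}`). -/
def Ap : LTS Unit Act3 :=
  ⟨fun _ x _ => x = Act3.a ∨ x = Act3.b⟩

/-- The two-state LTS `q` with `q →c q₁` and `q₁ →a q`, where `false` encodes `q`
and `true` encodes `q₁` (its alphabet is `{a, c}`). -/
def Aq : LTS Bool Act3 :=
  ⟨fun s x t => (s = false ∧ x = Act3.c ∧ t = true) ∨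
                (s = true ∧ x = Act3.a ∧ t = false)⟩

/-- In the composition of `Ap` and `Aq`, action `a` is not enabled in the initial process. -/
lemma not_enabled_sync_a :
    ¬ (LTS.Sync Ap Aq {Act3.a, Act3.b} {Act3.a, Act3.c}).Enabled ((), false) Act3.a := by
  rintro ⟨t, -, -, -, h, -⟩
  simpa [Aq] using h (by simp)

/-- The composition of `Ap` and `Aq` can loop forever in its initial process by `b`-steps. -/
lemma infRun_sync_b :
    (LTS.Sync Ap Aq {Act3.a, Act3.b} {Act3.a, Act3.c}).InfRun ((), false)
      (fun _ => ((), false)) (fun _ => Act3.b) :=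
  ⟨rfl, fun _ => by simp [LTS.Sync, Ap]⟩

/-- Fair languages are not compositional under synchronizing
parallel composition: for `F = {a}`, the trace `b^ω` is neither in the strong nor
in the weak fair language of `p`, yet it is in both the strong and the weak fair
language of the composed process `(p, q)` in `Ap ∥ Aq` (with alphabets `{a, b}`
and `{a, c}`, so `a` is synchronized, `b` is performed by `p` alone, `c` by `q`
alone). -/
theorem fair_languages_not_compositional :
    Sum.inr (fun _ => Act3.b) ∉ Ap.SFairLang {Act3.a} () ∧
    Sum.inr (fun _ => Act3.b) ∉ Ap.WFairLang {Act3.a} () ∧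
    Sum.inr (fun _ => Act3.b) ∈
      (LTS.Sync Ap Aq {Act3.a, Act3.b} {Act3.a, Act3.c}).SFairLang {Act3.a} ((), false) ∧
    Sum.inr (fun _ => Act3.b) ∈
      (LTS.Sync Ap Aq {Act3.a, Act3.b} {Act3.a, Act3.c}).WFairLang {Act3.a} ((), false) := by
  refine ⟨?_, ?_, ⟨_, infRun_sync_b, ?_⟩, ⟨_, infRun_sync_b, ?_⟩⟩
  · rintro ⟨s, -, hfair⟩
    obtain ⟨j, -, hj⟩ := hfair Act3.a rfl (fun i => ⟨i, le_rfl, (), Or.inl rfl⟩) 0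
    cases hj
  · rintro ⟨s, -, hfair⟩
    obtain ⟨j, -, hj⟩ := hfair Act3.a rfl ⟨0, fun _ _ => ⟨(), Or.inl rfl⟩⟩ 0
    cases hj
  · rintro _ rfl h
    obtain ⟨j, -, hj⟩ := h 0
    exact absurd hj not_enabled_sync_a
  · rintro _ rfl ⟨i, h⟩
    exact absurd (h i le_rfl) not_enabled_sync_a
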